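/- arXiv:1203.1758 — 4 statements merged into one kernel-verified Lean document; each statement's English description precedes it below -/
import Mathlib

section
/- Fix transmitter i with P_i > 0 and α_{ji} σ_j² ≥ 0 for all j ≠ i, and suppose the component of h_{ii} orthogonal to the span of the interference channels is nonzero, i.e., Π^⊥ h_{ii} ≠ 0, where Π^⊥ denotes the orthogonal projection onto the orthogonal complement of span{h_{ji} : j ≠ i} (this holds in particular when N ≥ K and {h_{ji} : j = 1, ..., K} are linearly independent). Then every maximizer v* of |⟨h_{ii}, v⟩|² over the feasible set F_i = {v ∈ ℂ^N : |⟨h_{ji}, v⟩|² ≤ α_{ji} σ_j² for all j ≠ i, and ‖v‖² ≤ P_i} uses full transmit power: ‖v*‖² = P_i. -/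
open scoped ComplexInnerProductSpace

/-- If the component of the desired channel `h i i` orthogonal to the span of the
interference channels is nonzero, then every maximizer of `|⟨h i i, ·⟩|²` over the
RZF feasible set uses full transmit power. -/
theorem RZF_maximizer_uses_full_power {K N : ℕ} (i : Fin K)
    (h : Fin K → Fin K → EuclideanSpace ℂ (Fin N))
    (σ : Fin K → ℝ) (α : Fin K → Fin K → ℝ) (Pi : ℝ) (hPi : 0 < Pi)
    (hα : ∀ j, j ≠ i → 0 ≤ α j i * (σ j) ^ 2)
    (hproj : (Submodule.orthogonalProjectionOnto
        (Submodule.span ℂ {x | ∃ j, j ≠ i ∧ x = h j i})ᗮ (h i i) :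
        EuclideanSpace ℂ (Fin N)) ≠ 0)
    (v : EuclideanSpace ℂ (Fin N))
    (hfeas : (∀ j, j ≠ i → ‖⟪h j i, v⟫‖ ^ 2 ≤ α j i * (σ j) ^ 2) ∧ ‖v‖ ^ 2 ≤ Pi)
    (hopt : ∀ w : EuclideanSpace ℂ (Fin N),
      (∀ j, j ≠ i → ‖⟪h j i, w⟫‖ ^ 2 ≤ α j i * (σ j) ^ 2) → ‖w‖ ^ 2 ≤ Pi →
      ‖⟪h i i, w⟫‖ ^ 2 ≤ ‖⟪h i i, v⟫‖ ^ 2) :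
    ‖v‖ ^ 2 = Pi := by
  by_contra hne
  have hlt : ‖v‖ ^ 2 < Pi := lt_of_le_of_ne hfeas.2 hne
  set S := Submodule.span ℂ {x | ∃ j, j ≠ i ∧ x = h j i} with hS
  set u : EuclideanSpace ℂ (Fin N) := (Submodule.orthogonalProjectionOnto Sᗮ (h i i) :
        EuclideanSpace ℂ (Fin N)) with hu
  have huS : u ∈ Sᗮ := Submodule.coe_mem _
  have horth : ∀ j, j ≠ i → ⟪h j i, u⟫ = 0 := by
    intro j hj
    exact (Submodule.mem_orthogonal _ _).1 huS _ (Submodule.subset_span ⟨j, hj, rfl⟩)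
  have hhu : ⟪h i i, u⟫ = ((‖u‖ ^ 2 : ℝ) : ℂ) := by
    have h1 : ⟪h i i - u, u⟫ = 0 :=
      Submodule.starProjection_inner_eq_zero (K := Sᗮ) (h i i) u huS
    rw [inner_sub_left, sub_eq_zero] at h1
    rw [h1, inner_self_eq_norm_sq_to_K]
    simp
  have hupos : 0 < ‖u‖ := norm_pos_iff.2 hproj
  have hvs : ‖v‖ < √Pi := Real.lt_sqrt_of_sq_lt hlt
  set t : ℝ := (√Pi - ‖v‖) / ‖u‖ with ht
  have htpos : 0 < t := div_pos (by linarith) hupos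
  set z := ⟪h i i, v⟫ with hz
  set ω : ℂ := Complex.exp (z.arg * Complex.I) with hω
  have hω1 : ‖ω‖ = 1 := Complex.norm_exp_ofReal_mul_I _
  have hzω : (‖z‖ : ℂ) * ω = z := Complex.norm_mul_exp_arg_mul_I z
  have key := hopt (v + ((t : ℂ) * ω) • u) ?_ ?_
  · have e : ⟪h i i, v + ((t : ℂ) * ω) • u⟫ = ((‖z‖ + t * ‖u‖ ^ 2 : ℝ) : ℂ) * ω := by
      rw [inner_add_right, inner_smul_right, hhu, ← hz]
      nth_rewrite 1 [← hzω]
      push_cast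
      ring
    have hp : 0 < t * ‖u‖ ^ 2 := by positivity
    rw [e, norm_mul, hω1, mul_one, Complex.norm_real, Real.norm_eq_abs, sq_abs] at key
    nlinarith [norm_nonneg z]
  · intro j hj
    rw [inner_add_right, inner_smul_right, horth j hj, mul_zero, add_zero]
    exact hfeas.1 j hj
  · have hn : ‖v + ((t : ℂ) * ω) • u‖ ≤ √Pi := by
      refine (norm_add_le _ _).trans ?_
      rw [norm_smul, norm_mul, hω1, mul_one, Complex.norm_real, Real.norm_eq_abs,
        abs_of_pos htpos, ht, div_mul_cancel₀ _ hupos.ne']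
      linarith
    calc _ ≤ √Pi ^ 2 := by gcongr
      _ = Pi := Real.sq_sqrt hPi.le
end

section
/- (Two-user RZF closed form, binding case.) Let h_{11}, h_{21} ∈ ℂ^N be linearly independent, P_1 > 0, and ασ_2² ≥ 0. Define v_1^{MF} = h_{11}/‖h_{11}‖, v_1^{ZF} = Π_{h_{21}}^⊥ h_{11} / ‖Π_{h_{21}}^⊥ h_{11}‖, and ρ = ‖Π_{h_{21}}^⊥ h_{11}‖ / ‖h_{11}‖ (which equals ⟨v_1^{MF}, v_1^{ZF}⟩ and satisfies 0 < ρ ≤ 1). Assume P_1 |⟨h_{21}, v_1^{MF}⟩|² > ασ_2², and set ξ_0 = √(ασ_2²)/|⟨h_{21}, v_1^{MF}⟩| and ξ_1 = −ρξ_0 + √(P_1 − ξ_0²(1 − ρ²)). Then the vector v_1 = ξ_0 v_1^{MF} + ξ_1 v_1^{ZF} maximizes |⟨h_{11}, v⟩|² over the feasible set {v ∈ ℂ^N : |⟨h_{21}, v⟩|² ≤ ασ_2², ‖v‖² ≤ P_1}. -/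
open scoped ComplexInnerProductSpace

/-- Projection of `x` onto the orthogonal complement of `span{g}`. -/
noncomputable def projPerp {N : ℕ} (g x : EuclideanSpace ℂ (Fin N)) :
    EuclideanSpace ℂ (Fin N) :=
  (Submodule.orthogonalProjectionOnto (Submodule.span ℂ {g})ᗮ x : EuclideanSpace ℂ (Fin N))

/-- The matched-filter direction `h₁₁/‖h₁₁‖`. -/
noncomputable def vMF {N : ℕ} (h11 : EuclideanSpace ℂ (Fin N)) : EuclideanSpace ℂ (Fin N) :=
  ‖h11‖⁻¹ • h11

/-- The zero-forcing direction `Π_{h₂₁}^⊥ h₁₁ / ‖Π_{h₂₁}^⊥ h₁₁‖`. -/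
noncomputable def vZF {N : ℕ} (h11 h21 : EuclideanSpace ℂ (Fin N)) :
    EuclideanSpace ℂ (Fin N) :=
  ‖projPerp h21 h11‖⁻¹ • projPerp h21 h11

/-- `ρ = ‖Π_{h₂₁}^⊥ h₁₁‖ / ‖h₁₁‖`. -/
noncomputable def rhoTwo {N : ℕ} (h11 h21 : EuclideanSpace ℂ (Fin N)) : ℝ :=
  ‖projPerp h21 h11‖ / ‖h11‖

/-- `ξ₀ = √(ασ₂²)/|⟨h₂₁, v₁^{MF}⟩|`. -/
noncomputable def xi0 {N : ℕ} (h11 h21 : EuclideanSpace ℂ (Fin N)) (ασ2 : ℝ) : ℝ :=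
  Real.sqrt ασ2 / ‖⟪h21, vMF h11⟫‖

/-- `ξ₁ = −ρ ξ₀ + √(P₁ − ξ₀²(1 − ρ²))`. -/
noncomputable def xi1 {N : ℕ} (h11 h21 : EuclideanSpace ℂ (Fin N)) (P1 ασ2 : ℝ) : ℝ :=
  -(rhoTwo h11 h21 * xi0 h11 h21 ασ2) +
    Real.sqrt (P1 - (xi0 h11 h21 ασ2) ^ 2 * (1 - (rhoTwo h11 h21) ^ 2))

/-- The two-user RZF beam `v₁ = ξ₀ v₁^{MF} + ξ₁ v₁^{ZF}`. -/
noncomputable def twoUserBeam {N : ℕ} (h11 h21 : EuclideanSpace ℂ (Fin N)) (P1 ασ2 : ℝ) :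
    EuclideanSpace ℂ (Fin N) :=
  xi0 h11 h21 ασ2 • vMF h11 + xi1 h11 h21 P1 ασ2 • vZF h11 h21

theorem rzf_core {E : Type*} [NormedAddCommGroup E] [InnerProductSpace ℂ E]
    (g u w q : E) (c : ℂ) (ρ P A : ℝ) (hu : ‖u‖ = 1) (hw : ‖w‖ = 1) (hgw : ⟪g, w⟫ = 0)
    (hq : q = c • g) (huq : u = (ρ : ℂ) • w + q) (hρ : 0 ≤ ρ) (hA : 0 ≤ A)
    (hb : P * ‖⟪g, u⟫‖ ^ 2 > A) (x R : ℝ) (hx : x = √A / ‖⟪g, u⟫‖)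
    (hR : R = √(P - x ^ 2 * (1 - ρ ^ 2))) (b : E)
    (hbe : b = (x : ℂ) • u + ((-(ρ * x) + R : ℝ) : ℂ) • w) :
    (‖⟪g, b⟫‖ ^ 2 ≤ A ∧ ‖b‖ ^ 2 ≤ P) ∧
      ∀ v : E, ‖⟪g, v⟫‖ ^ 2 ≤ A → ‖v‖ ^ 2 ≤ P → ‖⟪u, v⟫‖ ≤ ‖⟪u, b⟫‖ := by
  have hs : 0 < ‖⟪g, u⟫‖ := by
    rcases (norm_nonneg ⟪g, u⟫).eq_or_lt with h | h
    · rw [← h] at hb; norm_num at hb; linarith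
    · exact h
  have hwq : ⟪w, q⟫ = 0 := by
    rw [hq, inner_smul_right, inner_eq_zero_symm.mp hgw, mul_zero]
  have hqw : ⟪q, w⟫ = 0 := inner_eq_zero_symm.mp hwq
  have hww : ⟪w, w⟫ = 1 := by rw [inner_self_eq_norm_sq_to_K, hw]; simp
  have hgu : ⟪g, u⟫ = ⟪g, q⟫ := by rw [huq, inner_add_right, inner_smul_right, hgw]; simp
  -- Pythagoras in the plane spanned by `w` and `q`
  have pyth : ∀ s t : ℝ, ‖(s : ℂ) • w + (t : ℂ) • q‖ ^ 2 = s ^ 2 + t ^ 2 * ‖q‖ ^ 2 := by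
    intro s t
    have h := norm_add_sq_eq_norm_sq_add_norm_sq_of_inner_eq_zero ((s : ℂ) • w) ((t : ℂ) • q)
      (by rw [inner_smul_left, inner_smul_right, hwq]; simp)
    rw [norm_smul, norm_smul, hw, Complex.norm_real, Complex.norm_real, Real.norm_eq_abs,
      Real.norm_eq_abs] at h
    have h1 := sq_abs s
    have h2 := sq_abs t
    rw [pow_two, h, ← h1, ← h2]; ring
  have hk : ‖q‖ ^ 2 = 1 - ρ ^ 2 := by
    have h := pyth ρ 1
    rw [Complex.ofReal_one, one_smul, ← huq, hu] at h
    linarith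
  have hx0 : 0 ≤ x := by rw [hx]; positivity
  have hxs : x * ‖⟪g, u⟫‖ = √A := by rw [hx]; field_simp
  have hsA : √A ^ 2 = A := Real.sq_sqrt hA
  have hxP : x ^ 2 < P := by
    have : x ^ 2 * ‖⟪g, u⟫‖ ^ 2 < P * ‖⟪g, u⟫‖ ^ 2 := by
      rw [← mul_pow, hxs, hsA]; exact hb
    exact lt_of_mul_lt_mul_right this (by positivity)
  have hRpos : 0 < P - x ^ 2 * (1 - ρ ^ 2) := by nlinarith [sq_nonneg (x * ρ)]
  have hR0 : 0 < R := by rw [hR]; exact Real.sqrt_pos.mpr hRpos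
  have hR2 : R ^ 2 = P - x ^ 2 * (1 - ρ ^ 2) := by rw [hR]; exact Real.sq_sqrt hRpos.le
  have hRx : ρ * x ≤ R := by
    refine (abs_le_of_sq_le_sq' ?_ hR0.le).2
    nlinarith
  have hbw : b = (R : ℂ) • w + (x : ℂ) • q := by
    rw [hbe, huq]; push_cast; module
  have hbn : ‖b‖ ^ 2 = P := by rw [hbw, pyth, hk, hR2]; ring
  have hgb : ‖⟪g, b⟫‖ = √A := by
    rw [hbw, inner_add_right, inner_smul_right, inner_smul_right, hgw, ← hgu, mul_zero, zero_add,
      norm_mul, Complex.norm_real, Real.norm_of_nonneg hx0, hxs]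
  have hcs : ‖c‖ * ‖⟪g, u⟫‖ = 1 - ρ ^ 2 := by
    rw [← hk, hgu]
    have h : ‖⟪q, q⟫‖ = ‖q‖ ^ 2 := by
      rw [inner_self_eq_norm_sq_to_K]; simp
    rw [← h]
    conv_rhs => rw [hq, inner_smul_left, ← hq]
    simp
  have hk0 : 0 ≤ 1 - ρ ^ 2 := by rw [← hk]; positivity
  have hub : ‖⟪u, b⟫‖ = ρ * R + (1 - ρ ^ 2) * x := by
    have h : ⟪u, b⟫ = ((ρ * R + (1 - ρ ^ 2) * x : ℝ) : ℂ) := by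
      have hqq : ⟪q, q⟫ = ((1 - ρ ^ 2 : ℝ) : ℂ) := by
        rw [inner_self_eq_norm_sq_to_K, ← hk]; simp
      rw [hbw, huq]
      simp only [inner_add_left, inner_add_right, inner_smul_left, inner_smul_right, hww, hwq,
        hqw, hqq, Complex.conj_ofReal]
      push_cast; ring
    rw [h, Complex.norm_real, Real.norm_of_nonneg (by positivity)]
  refine ⟨⟨by rw [hgb, hsA], hbn.le⟩, fun v hv1 hv2 => ?_⟩
  have hgv : ‖⟪g, v⟫‖ ≤ √A := Real.le_sqrt_of_sq_le hv1
  have hqv : ‖⟪q, v⟫‖ ≤ (1 - ρ ^ 2) * x := by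
    rw [hq, inner_smul_left, norm_mul, RCLike.norm_conj, ← hcs]
    calc ‖c‖ * ‖⟪g, v⟫‖ ≤ ‖c‖ * √A := by gcongr
      _ = _ := by rw [← hxs]; ring
  have hbv : ‖⟪b, v⟫‖ ≤ P := by
    have h := norm_inner_le_norm (𝕜 := ℂ) b v
    nlinarith [sq_nonneg (‖b‖ - ‖v‖)]
  have hRu : (R : ℂ) • u = (ρ : ℂ) • b + ((R - ρ * x : ℝ) : ℂ) • q := by
    rw [hbw, huq]; push_cast; module
  have hRn : R * ‖⟪u, v⟫‖ ≤ ρ * ‖⟪b, v⟫‖ + (R - ρ * x) * ‖⟪q, v⟫‖ := by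
    have h1 : ‖⟪(R : ℂ) • u, v⟫‖ = R * ‖⟪u, v⟫‖ := by
      rw [inner_smul_left, norm_mul, Complex.conj_ofReal, Complex.norm_real,
        Real.norm_of_nonneg hR0.le]
    rw [← h1, hRu, inner_add_left, inner_smul_left, inner_smul_left, Complex.conj_ofReal,
      Complex.conj_ofReal]
    refine (norm_add_le _ _).trans_eq ?_
    rw [norm_mul, norm_mul, Complex.norm_real, Complex.norm_real, Real.norm_of_nonneg hρ,
      Real.norm_of_nonneg (sub_nonneg.mpr hRx)]
  rw [hub]
  have h1 := mul_le_mul_of_nonneg_left hbv hρ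
  have h2 := mul_le_mul_of_nonneg_left hqv (sub_nonneg.mpr hRx)
  refine le_of_mul_le_mul_left ?_ hR0
  have h3 : P = R ^ 2 + x ^ 2 * (1 - ρ ^ 2) := by linarith
  rw [h3] at h1
  nlinarith

/-- Two-user RZF closed form, binding case: when the full-power matched filter alone
would violate the leakage constraint, the vector `ξ₀ v₁^{MF} + ξ₁ v₁^{ZF}` is feasible
and maximizes `|⟨h₁₁, ·⟩|²` over the RZF feasible set
`{v : |⟨h₂₁, v⟩|² ≤ ασ₂², ‖v‖² ≤ P₁}`. -/
theorem two_user_RZF_closed_form {N : ℕ} (h11 h21 : EuclideanSpace ℂ (Fin N))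
    (hli : LinearIndependent ℂ ![h11, h21])
    (P1 : ℝ) (hP1 : 0 < P1) (ασ2 : ℝ) (hασ : 0 ≤ ασ2)
    (hbind : P1 * ‖⟪h21, vMF h11⟫‖ ^ 2 > ασ2) :
    (‖⟪h21, twoUserBeam h11 h21 P1 ασ2⟫‖ ^ 2 ≤ ασ2 ∧
      ‖twoUserBeam h11 h21 P1 ασ2‖ ^ 2 ≤ P1) ∧
    ∀ v : EuclideanSpace ℂ (Fin N),
      ‖⟪h21, v⟫‖ ^ 2 ≤ ασ2 → ‖v‖ ^ 2 ≤ P1 →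
      ‖⟪h11, v⟫‖ ^ 2 ≤ ‖⟪h11, twoUserBeam h11 h21 P1 ασ2⟫‖ ^ 2 := by
  have h110 : h11 ≠ 0 := by simpa using hli.ne_zero 0
  have hn : ‖h11‖ ≠ 0 := norm_ne_zero_iff.mpr h110
  have hmem : h11 - projPerp h21 h11 ∈ Submodule.span ℂ {h21} := by
    have h := Submodule.sub_starProjection_mem_orthogonal (K := (Submodule.span ℂ {h21})ᗮ) h11
    rw [Submodule.orthogonal_orthogonal] at h
    exact h
  obtain ⟨a, ha⟩ := Submodule.mem_span_singleton.mp hmem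
  have hp0 : projPerp h21 h11 ≠ 0 := by
    intro h
    rw [h, sub_zero] at ha
    have := LinearIndependent.pair_iff.mp hli 1 (-a) (by rw [← ha]; module)
    exact one_ne_zero this.1
  have hpn : ‖projPerp h21 h11‖ ≠ 0 := norm_ne_zero_iff.mpr hp0
  have hgp : ⟪h21, projPerp h21 h11⟫ = 0 :=
    Submodule.mem_orthogonal_singleton_iff_inner_right.mp
      (Submodule.orthogonalProjectionOnto (Submodule.span ℂ {h21})ᗮ h11).2
  have key := rzf_core h21 (vMF h11) (vZF h11 h21) (((‖h11‖⁻¹ : ℝ) * a : ℂ) • h21)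
    ((‖h11‖⁻¹ : ℝ) * a) (rhoTwo h11 h21) P1 ασ2
    (by rw [vMF, norm_smul, norm_inv, norm_norm, inv_mul_cancel₀ hn])
    (by rw [vZF, norm_smul, norm_inv, norm_norm, inv_mul_cancel₀ hpn])
    (by rw [vZF, ← Complex.coe_smul, inner_smul_right, hgp, mul_zero])
    rfl
    (by
      rw [mul_smul, ha, vMF, vZF, rhoTwo, Complex.coe_smul, Complex.coe_smul, smul_smul,
        smul_sub]
      have : ‖projPerp h21 h11‖ / ‖h11‖ * ‖projPerp h21 h11‖⁻¹ = ‖h11‖⁻¹ := by field_simp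
      rw [this]; abel)
    (by rw [rhoTwo]; positivity) hασ hbind (xi0 h11 h21 ασ2) _ rfl rfl
    (twoUserBeam h11 h21 P1 ασ2)
    (by rw [Complex.coe_smul, Complex.coe_smul]; rfl)
  refine ⟨key.1, fun v hv1 hv2 => ?_⟩
  have h := key.2 v hv1 hv2
  have hsc : ∀ y, ‖⟪h11, y⟫‖ = ‖h11‖ * ‖⟪vMF h11, y⟫‖ := by
    intro y
    rw [vMF, ← Complex.coe_smul, inner_smul_left, norm_mul, Complex.conj_ofReal,
      Complex.norm_real, norm_inv, norm_norm, mul_inv_cancel_left₀ hn]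
  rw [hsc, hsc]
  gcongr
end

section
/- (Two-user RZF closed form: tightness of the constraints.) Under the hypotheses of the two-user binding case — h_{11}, h_{21} ∈ ℂ^N linearly independent, P_1 > 0, ασ_2² ≥ 0, P_1 |⟨h_{21}, v_1^{MF}⟩|² > ασ_2², with v_1^{MF} = h_{11}/‖h_{11}‖, v_1^{ZF} = Π_{h_{21}}^⊥ h_{11}/‖Π_{h_{21}}^⊥ h_{11}‖, ρ = ‖Π_{h_{21}}^⊥ h_{11}‖/‖h_{11}‖, ξ_0 = √(ασ_2²)/|⟨h_{21}, v_1^{MF}⟩|, ξ_1 = −ρξ_0 + √(P_1 − ξ_0²(1−ρ²)) — the vector v_1 = ξ_0 v_1^{MF} + ξ_1 v_1^{ZF} satisfies both constraints with equality: |⟨h_{21}, v_1⟩|² = ασ_2² and ‖v_1‖² = P_1. -/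
open scoped ComplexInnerProductSpace

/-- Two-user RZF closed form, binding case: the beam `v₁ = ξ₀ v₁^{MF} + ξ₁ v₁^{ZF}`
satisfies both the leakage constraint and the power constraint with equality. -/
theorem two_user_RZF_constraints_tight {N : ℕ} (h11 h21 : EuclideanSpace ℂ (Fin N))
    (hli : LinearIndependent ℂ ![h11, h21])
    (P1 : ℝ) (hP1 : 0 < P1) (ασ2 : ℝ) (hασ : 0 ≤ ασ2)
    (hbind : P1 * ‖⟪h21, vMF h11⟫‖ ^ 2 > ασ2) :
    ‖⟪h21, twoUserBeam h11 h21 P1 ασ2⟫‖ ^ 2 = ασ2 ∧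
    ‖twoUserBeam h11 h21 P1 ασ2‖ ^ 2 = P1 := by
  have h11ne : h11 ≠ 0 := hli.ne_zero 0
  have hn : ‖h11‖ ≠ 0 := norm_ne_zero_iff.mpr h11ne
  have hmem : projPerp h21 h11 ∈ (Submodule.span ℂ {h21})ᗮ := by
    unfold projPerp
    exact Submodule.coe_mem _
  have hsub : h11 - projPerp h21 h11 ∈ Submodule.span ℂ {h21} := by
    have h := Submodule.sub_starProjection_mem_orthogonal (K := (Submodule.span ℂ {h21})ᗮ) h11
    rw [Submodule.orthogonal_orthogonal] at h
    exact h
  have hpne : projPerp h21 h11 ≠ 0 := by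
    intro h0
    rw [h0, sub_zero, Submodule.mem_span_singleton] at hsub
    obtain ⟨c, hc⟩ := hsub
    rw [LinearIndependent.pair_iff] at hli
    have := hli 1 (-c) (by rw [← hc]; simp)
    simp at this
  have hp : ‖projPerp h21 h11‖ ≠ 0 := norm_ne_zero_iff.mpr hpne
  have hz : ⟪h21, projPerp h21 h11⟫ = 0 :=
    hmem h21 (Submodule.mem_span_singleton_self h21)
  have hin : ⟪h11, projPerp h21 h11⟫ = ((‖projPerp h21 h11‖ ^ 2 : ℝ) : ℂ) := by
    have h := hmem _ hsub
    rw [inner_sub_left, sub_eq_zero] at h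
    rw [h, inner_self_eq_norm_sq_to_K]
    simp
  have hMF : ‖vMF h11‖ = 1 := by
    simp [vMF, norm_smul, hn]
  have hZF : ‖vZF h11 h21‖ = 1 := by
    simp [vZF, norm_smul, hp]
  have hzZF : ⟪h21, vZF h11 h21⟫ = 0 := by
    rw [vZF, inner_smul_right_eq_smul, hz, smul_zero]
  have hrho : ⟪vMF h11, vZF h11 h21⟫ = ((rhoTwo h11 h21 : ℝ) : ℂ) := by
    rw [vMF, vZF, rhoTwo, inner_smul_right_eq_smul, inner_smul_left_eq_smul, hin]
    simp only [Complex.real_smul, ← Complex.ofReal_mul]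
    congr 1
    field_simp
  have hg : 0 < ‖⟪h21, vMF h11⟫‖ := by
    rcases (norm_nonneg ⟪h21, vMF h11⟫).lt_or_eq with h | h
    · exact h
    · rw [← h] at hbind
      norm_num at hbind
      linarith
  have hx0 : xi0 h11 h21 ασ2 ^ 2 * ‖⟪h21, vMF h11⟫‖ ^ 2 = ασ2 := by
    rw [xi0, div_pow, Real.sq_sqrt hασ]
    field_simp
  have hx0le : xi0 h11 h21 ασ2 ^ 2 < P1 := by
    have h2 : 0 < ‖⟪h21, vMF h11⟫‖ ^ 2 := by positivity
    nlinarith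
  constructor
  · rw [twoUserBeam, inner_add_right, inner_smul_right_eq_smul, inner_smul_right_eq_smul, hzZF,
      smul_zero, add_zero, norm_smul, mul_pow, Real.norm_eq_abs, sq_abs, hx0]
  · have hS : 0 ≤ P1 - (xi0 h11 h21 ασ2) ^ 2 * (1 - (rhoTwo h11 h21) ^ 2) := by
      nlinarith [mul_nonneg (sq_nonneg (xi0 h11 h21 ασ2)) (sq_nonneg (rhoTwo h11 h21))]
    have hsq := Real.sq_sqrt hS
    rw [twoUserBeam, @norm_add_sq ℂ, inner_smul_right_eq_smul, inner_smul_left_eq_smul, hrho,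
      norm_smul, norm_smul, hMF, hZF]
    simp only [Complex.real_smul, ← Complex.ofReal_mul, mul_one, Real.norm_eq_abs, sq_abs]
    rw [RCLike.re_eq_complex_re, Complex.ofReal_re, xi1]
    linear_combination hsq
end

section
/- (Three-user SOPC solution, second case: feasibility and tightness.) Let h_{11}, h_{31} ∈ ℂ^N be linearly independent, P_1 > 0, α_{31}σ_3² ≥ 0, and suppose ⟨h_{31}, v_1^{MF}⟩ ≠ 0, where v_1^{MF} = h_{11}/‖h_{11}‖. Let u = Π_{h_{31}}^⊥ h_{11} / ‖Π_{h_{31}}^⊥ h_{11}‖, a = ‖Π_{h_{31}}^⊥ v_1^{MF}‖, β_0 = √(α_{31}σ_3²)/|⟨h_{31}, v_1^{MF}⟩|, and assume √P_1 > β_0; set β_1 = −aβ_0 + √(P_1 − (1 − a²)β_0²). Then the vector v = β_0 v_1^{MF} + β_1 u satisfies: (a) ⟨h_{31}, u⟩ = 0 and |⟨h_{31}, v⟩|² = α_{31}σ_3²; (b) ⟨v_1^{MF}, u⟩ = a (a real number); and (c) ‖v‖² = P_1. -/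
open scoped ComplexInnerProductSpace

/-- The normalized projection direction `u = Π_{h₃₁}^⊥ h₁₁ / ‖Π_{h₃₁}^⊥ h₁₁‖`. -/
noncomputable def uDir {N : ℕ} (h11 h31 : EuclideanSpace ℂ (Fin N)) :
    EuclideanSpace ℂ (Fin N) :=
  ‖projPerp h31 h11‖⁻¹ • projPerp h31 h11

/-- `a = ‖Π_{h₃₁}^⊥ v₁^{MF}‖`. -/
noncomputable def aCoef {N : ℕ} (h11 h31 : EuclideanSpace ℂ (Fin N)) : ℝ :=
  ‖projPerp h31 (vMF h11)‖

/-- `β₀ = √(α₃₁σ₃²)/|⟨h₃₁, v₁^{MF}⟩|`. -/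
noncomputable def beta0 {N : ℕ} (h11 h31 : EuclideanSpace ℂ (Fin N)) (ασ3 : ℝ) : ℝ :=
  Real.sqrt ασ3 / ‖⟪h31, vMF h11⟫‖

/-- `β₁ = −aβ₀ + √(P₁ − (1 − a²)β₀²)`. -/
noncomputable def beta1 {N : ℕ} (h11 h31 : EuclideanSpace ℂ (Fin N)) (P1 ασ3 : ℝ) : ℝ :=
  -(aCoef h11 h31 * beta0 h11 h31 ασ3) +
    Real.sqrt (P1 - (1 - (aCoef h11 h31) ^ 2) * (beta0 h11 h31 ασ3) ^ 2)

/-- The beam `v = β₀ v₁^{MF} + β₁ u` of the second case of the three-user SOPC solution. -/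
noncomputable def threeUserBeam2 {N : ℕ} (h11 h31 : EuclideanSpace ℂ (Fin N)) (P1 ασ3 : ℝ) :
    EuclideanSpace ℂ (Fin N) :=
  beta0 h11 h31 ασ3 • vMF h11 + beta1 h11 h31 P1 ασ3 • uDir h11 h31

theorem pp_orth {N : ℕ} (g x : EuclideanSpace ℂ (Fin N)) : (⟪g, projPerp g x⟫ : ℂ) = 0 := by
  have h : projPerp g x ∈ (Submodule.span ℂ {g})ᗮ := by
    unfold projPerp; exact Subtype.property _
  exact Submodule.mem_orthogonal_singleton_iff_inner_right.1 h

theorem pp_sub_mem {N : ℕ} (g x : EuclideanSpace ℂ (Fin N)) :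
    x - projPerp g x ∈ Submodule.span ℂ {g} := by
  have h := Submodule.sub_starProjection_mem_orthogonal (K := (Submodule.span ℂ {g})ᗮ) x
  rw [Submodule.orthogonal_orthogonal] at h
  exact h

theorem pp_inner {N : ℕ} (g x : EuclideanSpace ℂ (Fin N)) :
    (⟪x, projPerp g x⟫ : ℂ) = ((‖projPerp g x‖ ^ 2 : ℝ) : ℂ) := by
  obtain ⟨c, hc⟩ := Submodule.mem_span_singleton.1 (pp_sub_mem g x)
  have hx : x = c • g + projPerp g x := by rw [hc]; abel
  have h : (⟪c • g + projPerp g x, projPerp g x⟫ : ℂ) = ((‖projPerp g x‖ ^ 2 : ℝ) : ℂ) := by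
    rw [inner_add_left, inner_smul_left, pp_orth, inner_self_eq_norm_sq_to_K]
    simp
  rw [← hx] at h
  exact h

theorem pp_smul {N : ℕ} (g x : EuclideanSpace ℂ (Fin N)) (r : ℝ) :
    projPerp g (r • x) = r • projPerp g x := by
  have h : r • x = (r : ℂ) • x := (Complex.coe_smul r x).symm
  unfold projPerp
  rw [h, map_smul, Submodule.coe_smul, Complex.coe_smul]

theorem pp_ne {N : ℕ} (h11 h31 : EuclideanSpace ℂ (Fin N))
    (hli : LinearIndependent ℂ ![h11, h31]) : projPerp h31 h11 ≠ 0 := by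
  intro h0
  obtain ⟨c, hc⟩ := Submodule.mem_span_singleton.1 (pp_sub_mem h31 h11)
  rw [h0, sub_zero] at hc
  have := LinearIndependent.pair_iff.1 hli 1 (-c) (by rw [← hc]; simp)
  exact one_ne_zero this.1

/-- Three-user SOPC solution, second case: feasibility and tightness. The beam
`v = β₀ v₁^{MF} + β₁ u` satisfies `⟨h₃₁, u⟩ = 0`, hits the leakage constraint for
receiver 3 with equality, has `⟨v₁^{MF}, u⟩ = a` real, and uses full power. -/
theorem three_user_SOPC_case2_tight {N : ℕ} (h11 h31 : EuclideanSpace ℂ (Fin N))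
    (hli : LinearIndependent ℂ ![h11, h31])
    (P1 : ℝ) (hP1 : 0 < P1) (ασ3 : ℝ) (hασ : 0 ≤ ασ3)
    (hne : (⟪h31, vMF h11⟫ : ℂ) ≠ 0)
    (hβ : Real.sqrt P1 > beta0 h11 h31 ασ3) :
    ((⟪h31, uDir h11 h31⟫ : ℂ) = 0 ∧
      ‖⟪h31, threeUserBeam2 h11 h31 P1 ασ3⟫‖ ^ 2 = ασ3) ∧
    (⟪vMF h11, uDir h11 h31⟫ : ℂ) = ((aCoef h11 h31 : ℝ) : ℂ) ∧
    ‖threeUserBeam2 h11 h31 P1 ασ3‖ ^ 2 = P1 := by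
  have hp := pp_ne h11 h31 hli
  have hpn : ‖projPerp h31 h11‖ ≠ 0 := norm_ne_zero_iff.2 hp
  have hh : ‖h11‖ ≠ 0 := norm_ne_zero_iff.2 (hli.ne_zero 0)
  have hu0 : (⟪h31, uDir h11 h31⟫ : ℂ) = 0 := by
    unfold uDir
    rw [← Complex.coe_smul, inner_smul_right, pp_orth, mul_zero]
  have ha : aCoef h11 h31 = ‖h11‖⁻¹ * ‖projPerp h31 h11‖ := by
    unfold aCoef vMF
    rw [pp_smul, norm_smul, norm_inv, norm_norm]
  have hb : (⟪vMF h11, uDir h11 h31⟫ : ℂ) = ((aCoef h11 h31 : ℝ) : ℂ) := by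
    rw [ha]
    unfold vMF uDir
    rw [← Complex.coe_smul, ← Complex.coe_smul, inner_smul_right, inner_smul_left, pp_inner,
      Complex.conj_ofReal]
    norm_cast
    field_simp
  have hv1 : ‖vMF h11‖ = 1 := by
    unfold vMF; rw [norm_smul, norm_inv, norm_norm, inv_mul_cancel₀ hh]
  have hu1 : ‖uDir h11 h31‖ = 1 := by
    unfold uDir; rw [norm_smul, norm_inv, norm_norm, inv_mul_cancel₀ hpn]
  have hne' : ‖(⟪h31, vMF h11⟫ : ℂ)‖ ≠ 0 := norm_ne_zero_iff.2 hne
  have hb0 : 0 ≤ beta0 h11 h31 ασ3 := by unfold beta0; positivity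
  refine ⟨⟨hu0, ?_⟩, hb, ?_⟩
  · unfold threeUserBeam2
    rw [← Complex.coe_smul, ← Complex.coe_smul, inner_add_right, inner_smul_right,
      inner_smul_right, hu0, mul_zero, add_zero, norm_mul, Complex.norm_real, Real.norm_eq_abs,
      abs_of_nonneg hb0]
    unfold beta0
    rw [div_mul_cancel₀ _ hne', Real.sq_sqrt hασ]
  · have hle : beta0 h11 h31 ασ3 ^ 2 ≤ P1 := by
      have := Real.sq_sqrt hP1.le
      nlinarith
    have hs : 0 ≤ P1 - (1 - (aCoef h11 h31) ^ 2) * (beta0 h11 h31 ασ3) ^ 2 := by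
      nlinarith [sq_nonneg (aCoef h11 h31 * beta0 h11 h31 ασ3)]
    have hsq := Real.sq_sqrt hs
    have hexp : ‖threeUserBeam2 h11 h31 P1 ασ3‖ ^ 2 = beta0 h11 h31 ασ3 ^ 2
        + 2 * (beta0 h11 h31 ασ3 * beta1 h11 h31 P1 ασ3 * aCoef h11 h31)
        + beta1 h11 h31 P1 ασ3 ^ 2 := by
      unfold threeUserBeam2
      rw [← Complex.coe_smul, ← Complex.coe_smul, norm_add_sq (𝕜 := ℂ), inner_smul_right,
        inner_smul_left, hb, norm_smul, norm_smul, hv1, hu1, Complex.conj_ofReal,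
        Complex.norm_real, Complex.norm_real, mul_one, mul_one, Real.norm_eq_abs,
        Real.norm_eq_abs, sq_abs, sq_abs, ← Complex.ofReal_mul, ← Complex.ofReal_mul]
      simp only [RCLike.re_eq_complex_re, Complex.ofReal_re]
      ring
    rw [hexp]
    unfold beta1
    linear_combination hsq
end
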